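/- (Restricted Modular Law for Słomiński algebras.) Let X, Y, Z be subalgebras of a Słomiński algebra G such that Y is the kernel of some homomorphism of Słomiński algebras with domain G. If X ⊆ Z, then X ∨ (Y ∩ Z) = (X ∨ Y) ∩ Z, where ∨ denotes the join of subalgebras. -/

import Mathlib

universe u

/-- A Słomiński algebra: a set with a constant `zero` and binary operations `p`, `d`
satisfying `d x x = 0` and `p (d x y) y = x`. -/
structure Slominski (X : Type u) where
  zero : X
  p : X → X → X
  d : X → X → X
  d_self : ∀ x, d x x = zero
  p_d : ∀ x y, p (d x y) y = x

/-- A homomorphism of Słomiński algebras: a map preserving `zero`, `p` and `d`. -/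
def Slominski.IsHom {X Y : Type u} (SX : Slominski X) (SY : Slominski Y) (f : X → Y) : Prop :=
  f SX.zero = SY.zero ∧
    (∀ a b, f (SX.p a b) = SY.p (f a) (f b)) ∧
    (∀ a b, f (SX.d a b) = SY.d (f a) (f b))

/-- A subalgebra of a Słomiński algebra: a subset containing `zero` and closed under
`p` and `d`. -/
def Slominski.IsSubalgebra {X : Type u} (SX : Slominski X) (S : Set X) : Prop :=
  SX.zero ∈ S ∧
    (∀ a b, a ∈ S → b ∈ S → SX.p a b ∈ S) ∧
    (∀ a b, a ∈ S → b ∈ S → SX.d a b ∈ S)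

/-- The kernel of a homomorphism of Słomiński algebras. -/
def Slominski.ker {X Y : Type u} (SY : Slominski Y) (f : X → Y) : Set X :=
  {x | f x = SY.zero}

/-- The join of two subsets: the smallest subalgebra containing their union,
realized as the intersection of all subalgebras containing the union. -/
def Slominski.join {X : Type u} (SX : Slominski X) (A B : Set X) : Set X :=
  ⋂₀ {T | SX.IsSubalgebra T ∧ A ∪ B ⊆ T}

namespace Slominski

theorem IsSubalgebra.inter {G : Type u} {SG : Slominski G} {A B : Set G}
    (hA : SG.IsSubalgebra A) (hB : SG.IsSubalgebra B) : SG.IsSubalgebra (A ∩ B) :=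
  ⟨⟨hA.1, hB.1⟩,
    fun _ _ ha hb => ⟨hA.2.1 _ _ ha.1 hb.1, hB.2.1 _ _ ha.2 hb.2⟩,
    fun _ _ ha hb => ⟨hA.2.2 _ _ ha.1 hb.1, hB.2.2 _ _ ha.2 hb.2⟩⟩

theorem isSubalgebra_join {G : Type u} (SG : Slominski G) (A B : Set G) :
    SG.IsSubalgebra (SG.join A B) :=
  ⟨fun _ hT => hT.1.1,
    fun _ _ ha hb T hT => hT.1.2.1 _ _ (ha T hT) (hb T hT),
    fun _ _ ha hb T hT => hT.1.2.2 _ _ (ha T hT) (hb T hT)⟩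

theorem union_subset_join {G : Type u} (SG : Slominski G) (A B : Set G) :
    A ∪ B ⊆ SG.join A B :=
  fun _ ha _ hT => hT.2 ha

theorem join_subset {G : Type u} {SG : Slominski G} {A B T : Set G}
    (hT : SG.IsSubalgebra T) (h : A ∪ B ⊆ T) : SG.join A B ⊆ T :=
  fun _ hx => hx T ⟨hT, h⟩

/-- The saturation of a subalgebra under a homomorphism is a subalgebra. -/
theorem IsHom.isSubalgebra_preimage_image {G W : Type u} {SG : Slominski G} {SW : Slominski W}
    {g : G → W} (hg : SG.IsHom SW g) {A : Set G} (hA : SG.IsSubalgebra A) :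
    SG.IsSubalgebra (g ⁻¹' (g '' A)) := by
  refine ⟨⟨_, hA.1, rfl⟩, ?_, ?_⟩
  · rintro a b ⟨x, hx, hxa⟩ ⟨y, hy, hyb⟩
    exact ⟨SG.p x y, hA.2.1 _ _ hx hy, by rw [hg.2.1, hg.2.1, hxa, hyb]⟩
  · rintro a b ⟨x, hx, hxa⟩ ⟨y, hy, hyb⟩
    exact ⟨SG.d x y, hA.2.2 _ _ hx hy, by rw [hg.2.2, hg.2.2, hxa, hyb]⟩

/-- The join of a subalgebra with a kernel lies in the saturation of the subalgebra. -/
theorem IsHom.join_ker_subset {G W : Type u} {SG : Slominski G} {SW : Slominski W}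
    {g : G → W} (hg : SG.IsHom SW g) {A : Set G} (hA : SG.IsSubalgebra A) :
    SG.join A (SW.ker g) ⊆ g ⁻¹' (g '' A) := by
  refine join_subset (hg.isSubalgebra_preimage_image hA) ?_
  rintro x (hx | hx)
  · exact ⟨x, hx, rfl⟩
  · exact ⟨SG.zero, hA.1, hg.1.trans (Eq.symm hx)⟩

end Slominski

theorem slominski_restricted_modular_law {G : Type u} (SG : Slominski G)
    (X Y Z : Set G) (hX : SG.IsSubalgebra X) (hY : SG.IsSubalgebra Y)
    (hZ : SG.IsSubalgebra Z)
    (hYker : ∃ (W : Type u) (SW : Slominski W) (g : G → W),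
      SG.IsHom SW g ∧ Y = SW.ker g)
    (hXZ : X ⊆ Z) :
    SG.join X (Y ∩ Z) = SG.join X Y ∩ Z := by
  obtain ⟨W, SW, g, hg, rfl⟩ := hYker
  apply Set.Subset.antisymm
  · refine Slominski.join_subset ((SG.isSubalgebra_join _ _).inter hZ) ?_
    rintro x (hx | hx)
    · exact ⟨SG.union_subset_join _ _ (Or.inl hx), hXZ hx⟩
    · exact ⟨SG.union_subset_join _ _ (Or.inr hx.1), hx.2⟩
  · rintro z ⟨hz, hzZ⟩
    obtain ⟨x, hx, hxz⟩ := hg.join_ker_subset hX hz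
    have hker : SG.d z x ∈ SW.ker g := by
      change g (SG.d z x) = SW.zero
      rw [hg.2.2, hxz, SW.d_self]
    rw [← SG.p_d z x]
    exact (SG.isSubalgebra_join _ _).2.1 _ _
      (SG.union_subset_join _ _ (Or.inr ⟨hker, hZ.2.2 _ _ hzZ (hXZ hx)⟩))
      (SG.union_subset_join _ _ (Or.inl hx))
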